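/- arXiv:0812.0861 — 10 statements merged into one kernel-verified Lean document; each statement's English description precedes it below -/
import Mathlib

section
/- Let r, s, γ1, γ2 be real numbers. The system of seven linear inequalities X ≥ s, X ≥ r, X + Y ≥ r + s − γ1, Y ≥ 0, Y − X + γ1 + γ2 ≥ 0, X + Y ≤ r + s − γ2, X − Y ≥ γ1 admits a real solution (X, Y) ∈ ℝ² if and only if the following seven inequalities hold: γ2 ≥ 0, γ2 ≤ γ1, r − s ≤ γ1, s − r ≤ γ1, γ2 ≤ r, γ2 ≤ s, and γ1 + γ2 ≤ r + s. -/
theorem stmt_0 (r s γ1 γ2 : ℝ) :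
    (∃ X Y : ℝ,
      s ≤ X ∧ r ≤ X ∧ r + s - γ1 ≤ X + Y ∧ 0 ≤ Y ∧
      0 ≤ Y - X + γ1 + γ2 ∧ X + Y ≤ r + s - γ2 ∧ γ1 ≤ X - Y) ↔
    (0 ≤ γ2 ∧ γ2 ≤ γ1 ∧ r - s ≤ γ1 ∧ s - r ≤ γ1 ∧
      γ2 ≤ r ∧ γ2 ≤ s ∧ γ1 + γ2 ≤ r + s) := by
  constructor
  · rintro ⟨X, Y, h₁, h₂, h₃, h₄, h₅, h₆, h₇⟩
    refine ⟨?_, ?_, ?_, ?_, ?_, ?_, ?_⟩ <;> linarith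
  · rintro ⟨h₁, h₂, h₃, h₄, h₅, h₆, h₇⟩
    -- Maximise `X + Y = r + s - γ2`, then `X - Y = min (γ1 + γ2) (X + Y)`.
    rcases le_total (γ1 + γ2) (r + s - γ2) with h | h
    · refine ⟨(r + s + γ1) / 2, (r + s - γ1) / 2 - γ2, ?_, ?_, ?_, ?_, ?_, ?_, ?_⟩ <;> linarith
    · refine ⟨r + s - γ2, 0, ?_, ?_, ?_, ?_, ?_, ?_, ?_⟩ <;> linarith
end

section
/- For all integers r, s, γ1, γ2: R(r, s, γ1, γ2) > 0 if and only if γ2 ≥ 0, γ2 ≤ γ1, r − s ≤ γ1, s − r ≤ γ1, γ2 ≤ r, γ2 ≤ s, and γ1 + γ2 ≤ r + s. (In other words, the reduced Kronecker coefficients indexed by two one-row shapes are positive exactly on the integral points of the rational polyhedral cone Δ' described by these seven inequalities.) -/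
/-- `R r s γ1 γ2` counts the integral points `(X, Y)` satisfying the seven
inequalities `X ≥ s`, `X ≥ r`, `X + Y ≥ r + s − γ1`, `Y ≥ 0`,
`Y − X + γ1 + γ2 ≥ 0`, `X + Y ≤ r + s − γ2`, `X − Y ≥ γ1`. -/
noncomputable def R (r s γ1 γ2 : ℤ) : ℕ :=
  Set.ncard {p : ℤ × ℤ |
    s ≤ p.1 ∧ r ≤ p.1 ∧ r + s - γ1 ≤ p.1 + p.2 ∧ 0 ≤ p.2 ∧
    0 ≤ p.2 - p.1 + γ1 + γ2 ∧ p.1 + p.2 ≤ r + s - γ2 ∧ γ1 ≤ p.1 - p.2}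

/-- The set of integral points counted by `R` is finite. -/
theorem finite_setOf_points (r s γ1 γ2 : ℤ) :
    {p : ℤ × ℤ |
      s ≤ p.1 ∧ r ≤ p.1 ∧ r + s - γ1 ≤ p.1 + p.2 ∧ 0 ≤ p.2 ∧
      0 ≤ p.2 - p.1 + γ1 + γ2 ∧ p.1 + p.2 ≤ r + s - γ2 ∧ γ1 ≤ p.1 - p.2}.Finite := by
  refine ((Set.finite_Icc r (r + s - γ2)).prod (Set.finite_Icc 0 (s - γ2))).subset ?_
  rintro ⟨x, y⟩ h
  simp only [Set.mem_ofPred_eq, Set.mem_prod, Set.mem_Icc] at h ⊢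
  omega

/-- On the integral points of the cone, the polygon contains an integral point: take the least
admissible ordinate, then the least abscissa above it. -/
theorem exists_point_of_mem_cone {r s γ1 γ2 : ℤ} (h0 : 0 ≤ γ2) (h21 : γ2 ≤ γ1)
    (hrs : r - s ≤ γ1) (hsr : s - r ≤ γ1) (hr : γ2 ≤ r) (hs : γ2 ≤ s)
    (hsum : γ1 + γ2 ≤ r + s) :
    ∃ x y : ℤ, s ≤ x ∧ r ≤ x ∧ r + s - γ1 ≤ x + y ∧ 0 ≤ y ∧
      0 ≤ y - x + γ1 + γ2 ∧ x + y ≤ r + s - γ2 ∧ γ1 ≤ x - y := by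
  obtain ⟨y, hy⟩ : ∃ y, y = max 0 (max (max r s - γ1 - γ2) ((r + s - 2 * γ1 - γ2 + 1) / 2)) :=
    ⟨_, rfl⟩
  have y_le : y ≤ r - γ2 ∧ y ≤ s - γ2 ∧ 2 * y ≤ r + s - γ1 - γ2 := by omega
  have le_y : 0 ≤ y ∧ r - γ1 - γ2 ≤ y ∧ s - γ1 - γ2 ≤ y ∧ r + s - 2 * γ1 - γ2 ≤ 2 * y := by
    omega
  clear hy
  refine ⟨max (max r s) (max (r + s - γ1 - y) (γ1 + y)), y, ?_⟩
  omega

theorem stmt_1 (r s γ1 γ2 : ℤ) :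
    0 < R r s γ1 γ2 ↔
    (0 ≤ γ2 ∧ γ2 ≤ γ1 ∧ r - s ≤ γ1 ∧ s - r ≤ γ1 ∧
      γ2 ≤ r ∧ γ2 ≤ s ∧ γ1 + γ2 ≤ r + s) := by
  rw [R, Set.ncard_pos (finite_setOf_points r s γ1 γ2)]
  constructor
  · rintro ⟨⟨x, y⟩, h⟩
    simp only [Set.mem_ofPred_eq] at h
    omega
  · rintro ⟨h0, h21, hrs, hsr, hr, hs, hsum⟩
    obtain ⟨x, y, h⟩ := exists_point_of_mem_cone h0 h21 hrs hsr hr hs hsum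
    exact ⟨(x, y), h⟩
end

section
/- Let r, s, γ1, γ2 be integers satisfying 0 ≤ γ2 ≤ s ≤ r, s ≤ γ1, r + s ≤ γ1 + 2γ2, and s + γ1 ≤ r + γ2. Then R(r, s, γ1, γ2) = (s − γ2 + 1)(s − γ2 + 2)/2. (This is the quasipolynomial formula q_135 valid on the closure of the chamber σ_{135}, on which the polygon is the triangle X ≥ r, Y ≥ 0, X + Y ≤ r + s − γ2.) -/
/-- The number of lattice points in the triangle `r ≤ X`, `0 ≤ Y`, `X + Y ≤ r + n`,
counted along the antidiagonals `X + Y = r + k`. -/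
theorem two_mul_ncard_triangle (r : ℤ) (n : ℕ) :
    2 * Set.ncard {p : ℤ × ℤ | r ≤ p.1 ∧ 0 ≤ p.2 ∧ p.1 + p.2 ≤ r + n} = (n + 1) * (n + 2) := by
  have himage : {p : ℤ × ℤ | r ≤ p.1 ∧ 0 ≤ p.2 ∧ p.1 + p.2 ≤ r + n} =
      (fun q : (_ : ℕ) × ℕ => (r + q.1 - q.2, (q.2 : ℤ))) ''
        ((Finset.range (n + 1)).sigma fun k => Finset.range (k + 1)) := by
    ext ⟨x, y⟩
    simp only [Set.mem_ofPred_eq, Set.mem_image, Finset.mem_coe, Finset.mem_sigma,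
      Finset.mem_range, Prod.mk.injEq]
    constructor
    · rintro ⟨hx, hy, hxy⟩
      refine ⟨⟨(x + y - r).toNat, y.toNat⟩, ?_⟩
      dsimp only
      omega
    · rintro ⟨⟨k, b⟩, hq⟩
      dsimp only at hq
      omega
  have hinj : Function.Injective
      (fun q : (_ : ℕ) × ℕ => (r + q.1 - q.2, (q.2 : ℤ))) := by
    rintro ⟨k, b⟩ ⟨k', b'⟩ h
    simp only [Prod.mk.injEq] at h
    obtain rfl : k = k' := by omega
    obtain rfl : b = b' := by omega
    rfl
  rw [himage, Set.ncard_image_of_injective _ hinj, Set.ncard_coe_finset, Finset.card_sigma]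
  simp only [Finset.card_range]
  clear himage
  induction n with
  | zero => simp
  | succ m ih =>
    rw [Finset.sum_range_succ, mul_add, ih]
    ring

theorem stmt_2 (r s γ1 γ2 : ℤ)
    (h1 : 0 ≤ γ2) (h2 : γ2 ≤ s) (h3 : s ≤ r) (h4 : s ≤ γ1)
    (h5 : r + s ≤ γ1 + 2 * γ2) (h6 : s + γ1 ≤ r + γ2) :
    2 * (R r s γ1 γ2 : ℤ) = (s - γ2 + 1) * (s - γ2 + 2) := by
  lift s - γ2 to ℕ using by omega with n hn
  rw [R, show {p : ℤ × ℤ | s ≤ p.1 ∧ r ≤ p.1 ∧ r + s - γ1 ≤ p.1 + p.2 ∧ 0 ≤ p.2 ∧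
      0 ≤ p.2 - p.1 + γ1 + γ2 ∧ p.1 + p.2 ≤ r + s - γ2 ∧ γ1 ≤ p.1 - p.2} =
      {p : ℤ × ℤ | r ≤ p.1 ∧ 0 ≤ p.2 ∧ p.1 + p.2 ≤ r + n} by
    ext ⟨x, y⟩
    simp only [Set.mem_ofPred_eq]
    omega]
  exact_mod_cast two_mul_ncard_triangle r n
end

section
/- Let r, s, γ1, γ2 be integers satisfying γ2 ≥ 0, r ≤ γ1, s ≤ γ1, and γ1 + γ2 ≤ r + s ≤ γ1 + 2γ2. Then R(r, s, γ1, γ2) = ⌊(r + s − γ1 − γ2 + 2)² / 4⌋. (This is the quasipolynomial formula valid on the closure of the chamber σ_{356}, on which the polygon is the triangle Y ≥ 0, X + Y ≤ r + s − γ2, X − Y ≥ γ1.) -/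
/-- The number of lattice points `(a, y)` with `a, y ≥ 0` and `a + 2 * y ≤ n`. -/
theorem card_sigma_range_sub_two_mul (n : ℕ) :
    (((Finset.range (n / 2 + 1)).sigma fun y => Finset.range (n + 1 - 2 * y)).card : ℤ) =
      ((n : ℤ) + 2) ^ 2 / 4 := by
  have sum_eq : ∀ k : ℕ, 2 * k ≤ n + 2 →
      ((∑ y ∈ Finset.range k, (n + 1 - 2 * y) : ℕ) : ℤ) = k * (n + 2 - k) := by
    intro k
    induction k with
    | zero => simp
    | succ k ih =>
      intro hk
      rw [Finset.sum_range_succ, Nat.cast_add, ih (by omega), Nat.cast_sub (by omega)]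
      push_cast
      ring
  simp only [Finset.card_sigma, Finset.card_range]
  rw [sum_eq _ (by omega)]
  obtain ⟨m, rfl | rfl⟩ := Nat.even_or_odd' n
  · rw [show 2 * m / 2 = m by omega]
    push_cast
    rw [show (2 * (m : ℤ) + 2) ^ 2 = (m + 1) ^ 2 * 4 by ring,
      Int.mul_ediv_cancel _ (by norm_num)]
    ring
  · rw [show (2 * m + 1) / 2 = m by omega]
    push_cast
    rw [show (2 * (m : ℤ) + 1 + 2) ^ 2 = 1 + ((m + 1) * (m + 2)) * 4 by ring,
      Int.add_mul_ediv_right _ _ (by norm_num)]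
    rw [show (1 : ℤ) / 4 = 0 by norm_num]
    ring

theorem stmt_3 (r s γ1 γ2 : ℤ)
    (h1 : 0 ≤ γ2) (h2 : r ≤ γ1) (h3 : s ≤ γ1)
    (h4 : γ1 + γ2 ≤ r + s) (h5 : r + s ≤ γ1 + 2 * γ2) :
    (R r s γ1 γ2 : ℤ) = (r + s - γ1 - γ2 + 2) ^ 2 / 4 := by
  obtain ⟨n, hn⟩ := Int.eq_ofNat_of_zero_le (show 0 ≤ r + s - γ1 - γ2 by omega)
  rw [hn, ← card_sigma_range_sub_two_mul n, R, ← Set.ncard_coe_finset, Nat.cast_inj]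
  symm
  refine Set.ncard_congr (fun q _ => (γ1 + q.1 + q.2, (q.1 : ℤ))) ?_ ?_ ?_
  · rintro ⟨y, a⟩ h
    simp only [Finset.coe_sigma, Set.mem_sigma_iff, Finset.coe_range, Set.mem_Iio] at h
    simp only [Set.mem_ofPred_eq]
    omega
  · rintro ⟨y, a⟩ ⟨y', a'⟩ _ _ h
    simp only [Prod.mk.injEq] at h
    obtain rfl : y = y' := by omega
    obtain rfl : a = a' := by omega
    rfl
  · rintro ⟨X, Y⟩ h
    simp only [Set.mem_ofPred_eq] at h
    refine ⟨⟨Y.toNat, (X - Y - γ1).toNat⟩, ?_, ?_⟩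
    · simp only [Finset.coe_sigma, Set.mem_sigma_iff, Finset.coe_range, Set.mem_Iio]
      omega
    · simp only [Prod.mk.injEq]
      omega
end

section
/- Let r, s, γ1, γ2 be integers satisfying γ2 ≥ 0, γ1 + γ2 ≤ r, s + γ2 ≤ r ≤ s + γ1, and s + γ1 ≤ r + γ2. Then R(r, s, γ1, γ2) = ⌊(s − r + γ1 + 2)² / 4⌋. (This is the quasipolynomial formula valid on the closure of the chamber σ_{145}, on which the polygon is the triangle X ≥ r, Y − X + γ1 + γ2 ≥ 0, X + Y ≤ r + s − γ2.) -/
/-- The lattice points of the triangle `0 ≤ x`, `0 ≤ y`, `2 * x + y ≤ n`, column by column. -/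
def trianglePoints (n : ℕ) : Finset (Σ _ : ℕ, ℕ) :=
  (Finset.range (n / 2 + 1)).sigma fun x => Finset.range (n + 1 - 2 * x)

theorem mem_trianglePoints {n : ℕ} {p : Σ _ : ℕ, ℕ} :
    p ∈ trianglePoints n ↔ 2 * p.1 + p.2 ≤ n := by
  simp only [trianglePoints, Finset.mem_sigma, Finset.mem_range]
  omega

theorem sum_range_sub_two_mul (n k : ℕ) (hk : 2 * k ≤ n + 2) :
    ((∑ x ∈ Finset.range k, (n + 1 - 2 * x) : ℕ) : ℤ) = k * (n + 2 - k) := by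
  induction k with
  | zero => simp
  | succ k ih =>
    rw [Finset.sum_range_succ, Nat.cast_add, ih (by omega), Nat.cast_sub (by omega)]
    push_cast
    ring

theorem card_trianglePoints (n : ℕ) :
    ((trianglePoints n).card : ℤ) = ((n : ℤ) + 2) ^ 2 / 4 := by
  simp only [trianglePoints, Finset.card_sigma, Finset.card_range]
  rw [sum_range_sub_two_mul n _ (by omega)]
  obtain ⟨m, rfl | rfl⟩ := n.even_or_odd'
  · rw [show 2 * m / 2 = m by omega]
    push_cast
    rw [show (2 * (m : ℤ) + 2) ^ 2 = ((m : ℤ) + 1) ^ 2 * 4 by ring,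
      Int.mul_ediv_cancel _ (by norm_num)]
    ring
  · rw [show (2 * m + 1) / 2 = m by omega]
    push_cast
    rw [show (2 * (m : ℤ) + 1 + 2) ^ 2 = 1 + ((m : ℤ) + 1) * (m + 2) * 4 by ring,
      Int.add_mul_ediv_right _ _ (by norm_num)]
    rw [show (1 : ℤ) / 4 = 0 by norm_num]
    ring

theorem stmt_4 (r s γ1 γ2 : ℤ)
    (h1 : 0 ≤ γ2) (h2 : γ1 + γ2 ≤ r) (h3 : s + γ2 ≤ r)
    (h4 : r ≤ s + γ1) (h5 : s + γ1 ≤ r + γ2) :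
    (R r s γ1 γ2 : ℤ) = (s - r + γ1 + 2) ^ 2 / 4 := by
  obtain ⟨n, hn⟩ := Int.eq_ofNat_of_zero_le (show 0 ≤ s - r + γ1 by omega)
  let f : (Σ _ : ℕ, ℕ) → ℤ × ℤ := fun p => (r + p.1, r + p.1 - γ1 - γ2 + p.2)
  have hf : Function.Injective f := by
    rintro ⟨x, y⟩ ⟨x', y'⟩ h
    simp only [f, Prod.mk.injEq] at h
    obtain rfl : x = x' := by omega
    obtain rfl : y = y' := by omega
    rfl
  rw [hn, ← card_trianglePoints, ← Set.ncard_coe_finset, ← Set.ncard_image_of_injective _ hf, R]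
  congr 2
  ext ⟨X, Y⟩
  simp only [Set.mem_ofPred_eq, Set.mem_image, Finset.mem_coe, mem_trianglePoints, f, Prod.mk.injEq]
  constructor
  · intro h
    refine ⟨⟨(X - r).toNat, (Y - X + γ1 + γ2).toNat⟩, ?_, ?_, ?_⟩ <;> dsimp only <;> omega
  · rintro ⟨⟨x, y⟩, h, rfl, rfl⟩
    dsimp only at h ⊢
    omega
end

section
/- Let r, s, γ1, γ2 be integers satisfying γ2 ≥ 0, γ2 ≤ γ1, r − s ≤ γ1, s − r ≤ γ1, γ2 ≤ r, γ2 ≤ s, and γ1 + γ2 ≤ r + s (i.e., (r, s, γ1, γ2) lies in the cone Δ'). If moreover at least one of the five equalities s = γ2, r = γ2, r + s = γ1 + γ2, r = s + γ1, s = r + γ1 holds (i.e., the point lies on one of the corresponding facets of Δ'), then R(r, s, γ1, γ2) = 1. -/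
/-- If some integral point is the only solution of the seven inequalities, then `R = 1`. -/
theorem R_eq_one_of_unique {r s γ1 γ2 : ℤ} (a b : ℤ)
    (h : ∀ x y : ℤ, (s ≤ x ∧ r ≤ x ∧ r + s - γ1 ≤ x + y ∧ 0 ≤ y ∧
      0 ≤ y - x + γ1 + γ2 ∧ x + y ≤ r + s - γ2 ∧ γ1 ≤ x - y) ↔ x = a ∧ y = b) :
    R r s γ1 γ2 = 1 := by
  rw [R, Set.ncard_eq_one]
  refine ⟨(a, b), ?_⟩
  ext ⟨x, y⟩
  simpa using h x y

theorem stmt_6 (r s γ1 γ2 : ℤ)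
    (h1 : 0 ≤ γ2) (h2 : γ2 ≤ γ1) (h3 : r - s ≤ γ1) (h4 : s - r ≤ γ1)
    (h5 : γ2 ≤ r) (h6 : γ2 ≤ s) (h7 : γ1 + γ2 ≤ r + s)
    (hfacet : s = γ2 ∨ r = γ2 ∨ r + s = γ1 + γ2 ∨ r = s + γ1 ∨ s = r + γ1) :
    R r s γ1 γ2 = 1 := by
  rcases hfacet with h | h | h | h | h
  · exact R_eq_one_of_unique r 0 fun x y => by omega
  · exact R_eq_one_of_unique s 0 fun x y => by omega
  · exact R_eq_one_of_unique γ1 0 fun x y => by omega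
  · exact R_eq_one_of_unique r (s - γ2) fun x y => by omega
  · exact R_eq_one_of_unique s (r - γ2) fun x y => by omega
end

section
/- For every (r, s, γ1, γ2) ∈ ℤ⁴ there exist polynomials p₀, p₁ with rational coefficients, each of degree at most 2, such that for every integer N ≥ 1 one has R(Nr, Ns, Nγ1, Nγ2) = p₀(N) if N is even and R(Nr, Ns, Nγ1, Nγ2) = p₁(N) if N is odd. (The stretching function of a reduced Kronecker coefficient indexed by two one-row shapes is a quadratic quasipolynomial of period dividing 2.) -/
/-- `F` agrees, at all positive integers, with a quadratic quasipolynomial of period dividing 2. -/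
def IsQuadraticQuasipoly (F : ℤ → ℚ) : Prop :=
  ∃ a b c : ℤ → ℚ, ∀ N : ℤ, 1 ≤ N → F N = a (N % 2) * (N : ℚ) ^ 2 + b (N % 2) * N + c (N % 2)

namespace IsQuadraticQuasipoly

variable {F G : ℤ → ℚ}

theorem add (hF : IsQuadraticQuasipoly F) (hG : IsQuadraticQuasipoly G) :
    IsQuadraticQuasipoly (fun N => F N + G N) := by
  obtain ⟨a, b, c, h⟩ := hF
  obtain ⟨a', b', c', h'⟩ := hG
  refine ⟨a + a', b + b', c + c', fun N hN => ?_⟩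
  simp only [h N hN, h' N hN, Pi.add_apply]
  ring

theorem sub (hF : IsQuadraticQuasipoly F) (hG : IsQuadraticQuasipoly G) :
    IsQuadraticQuasipoly (fun N => F N - G N) := by
  obtain ⟨a, b, c, h⟩ := hF
  obtain ⟨a', b', c', h'⟩ := hG
  refine ⟨a - a', b - b', c - c', fun N hN => ?_⟩
  simp only [h N hN, h' N hN, Pi.sub_apply]
  ring

theorem congr (hF : IsQuadraticQuasipoly F) (h : ∀ N, 1 ≤ N → G N = F N) :
    IsQuadraticQuasipoly G := by
  obtain ⟨a, b, c, h'⟩ := hF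
  exact ⟨a, b, c, fun N hN => (h N hN).trans (h' N hN)⟩

theorem exists_polynomial (hF : IsQuadraticQuasipoly F) :
    ∃ p₀ p₁ : Polynomial ℚ, p₀.degree ≤ 2 ∧ p₁.degree ≤ 2 ∧
      ∀ N : ℤ, 1 ≤ N →
        (Even N → F N = p₀.eval (N : ℚ)) ∧ (Odd N → F N = p₁.eval (N : ℚ)) := by
  obtain ⟨a, b, c, h⟩ := hF
  let p (i : ℤ) : Polynomial ℚ :=
    Polynomial.C (a i) * Polynomial.X ^ 2 + Polynomial.C (b i) * Polynomial.X + Polynomial.C (c i)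
  refine ⟨p 0, p 1, Polynomial.degree_quadratic_le, Polynomial.degree_quadratic_le,
    fun N hN => ⟨fun hE => ?_, fun hO => ?_⟩⟩
  · simp [p, h N hN, Int.even_iff.mp hE]
  · simp [p, h N hN, Int.odd_iff.mp hO]

end IsQuadraticQuasipoly

/-- The integers `X` with `N * a ≤ 2 * X ≤ N * b`. -/
noncomputable def halfInterval (a b N : ℤ) : Finset ℤ := Finset.Icc ((N * a + 1) / 2) (N * b / 2)

theorem mem_halfInterval {a b N X : ℤ} :
    X ∈ halfInterval a b N ↔ N * a ≤ 2 * X ∧ 2 * X ≤ N * b := by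
  rw [halfInterval, Finset.mem_Icc]
  omega

/-- Summing `h N` over every dilated interval with half-integral ends gives a quadratic
quasipolynomial in the dilation factor `N`. -/
def HasQuasipolySums (h : ℤ → ℤ → ℤ) : Prop :=
  ∀ a b : ℤ, a ≤ b →
    IsQuadraticQuasipoly (fun N => ((∑ X ∈ halfInterval a b N, h N X : ℤ) : ℚ))

theorem sum_Icc_affine (α β p q : ℤ) (hpq : p ≤ q + 1) :
    ((∑ X ∈ Finset.Icc p q, (α * X + β) : ℤ) : ℚ) =
      ((q : ℚ) - p + 1) * (α * ((p : ℚ) + q) / 2 + β) := by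
  obtain ⟨n, hn⟩ := Int.eq_ofNat_of_zero_le (by omega : 0 ≤ q + 1 - p)
  obtain rfl : q = p + n - 1 := by omega
  clear hpq hn
  induction n with
  | zero => simp
  | succ n ih =>
    have hI : Finset.Icc p (p + (n + 1 : ℕ) - 1) = insert (p + n) (Finset.Icc p (p + n - 1)) := by
      ext x
      simp only [Finset.mem_Icc, Finset.mem_insert]
      omega
    rw [hI, Finset.sum_insert (by simp), Int.cast_add, ih]
    push_cast
    ring

namespace HasQuasipolySums

variable {g h : ℤ → ℤ → ℤ}

theorem affine (α β κ : ℤ) : HasQuasipolySums (fun N X => α * X + (β * N + κ)) := by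
  intro a b hab
  let d (i : ℤ) : ℚ := ((i * a % 2 : ℤ) : ℚ) / 2
  let e (i : ℤ) : ℚ := -((i * b % 2 : ℤ) : ℚ) / 2
  refine ⟨fun _ => ((b - a) / 2) * (α * (a + b) / 4 + β),
    fun i => ((b - a) / 2) * (α * (d i + e i) / 2 + κ) +
      (e i - d i + 1) * (α * (a + b) / 4 + β),
    fun i => (e i - d i + 1) * (α * (d i + e i) / 2 + κ), fun N hN => ?_⟩
  have hmul : N * a ≤ N * b := mul_le_mul_of_nonneg_left hab (by omega)
  have hp : (((N * a + 1) / 2 : ℤ) : ℚ) = N * a / 2 + d (N % 2) := by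
    have h1 : N % 2 * a % 2 = N * a % 2 := by simp [Int.mul_emod]
    have h2 : 2 * ((N * a + 1) / 2) = N * a + N % 2 * a % 2 := by rw [h1]; omega
    have h3 : (2 : ℚ) * (((N * a + 1) / 2 : ℤ) : ℚ) = N * a + ((N % 2 * a % 2 : ℤ) : ℚ) := by
      exact_mod_cast h2
    simp only [d]
    linarith
  have hq : ((N * b / 2 : ℤ) : ℚ) = N * b / 2 + e (N % 2) := by
    have h1 : N % 2 * b % 2 = N * b % 2 := by simp [Int.mul_emod]
    have h2 : 2 * (N * b / 2) = N * b - N % 2 * b % 2 := by rw [h1]; omega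
    have h3 : (2 : ℚ) * ((N * b / 2 : ℤ) : ℚ) = N * b - ((N % 2 * b % 2 : ℤ) : ℚ) := by
      exact_mod_cast h2
    simp only [e]
    linarith
  simp only [halfInterval]
  rw [sum_Icc_affine _ _ _ _ (by omega), hp, hq]
  push_cast
  ring

theorem add (hg : HasQuasipolySums g) (hh : HasQuasipolySums h) :
    HasQuasipolySums (fun N X => g N X + h N X) := fun a b hab =>
  ((hg a b hab).add (hh a b hab)).congr fun N _ => by rw [Finset.sum_add_distrib, Int.cast_add]

theorem sub (hg : HasQuasipolySums g) (hh : HasQuasipolySums h) :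
    HasQuasipolySums (fun N X => g N X - h N X) := fun a b hab =>
  ((hg a b hab).sub (hh a b hab)).congr fun N _ => by rw [Finset.sum_sub_distrib, Int.cast_sub]

theorem piecewise {f : ℤ → ℤ → ℤ} (hg : HasQuasipolySums g) (hh : HasQuasipolySums h) (c : ℤ)
    (hfg : ∀ N X, 1 ≤ N → 2 * X ≤ N * c → f N X = g N X)
    (hfh : ∀ N X, 1 ≤ N → N * c ≤ 2 * X → f N X = h N X) : HasQuasipolySums f := by
  intro a b hab
  rcases le_total c a with hca | hac
  · refine (hh a b hab).congr fun N hN => ?_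
    have := mul_le_mul_of_nonneg_left hca (by omega : 0 ≤ N)
    congr 1
    refine Finset.sum_congr rfl fun X hX => hfh N X hN ?_
    rw [mem_halfInterval] at hX
    omega
  rcases le_total b c with hbc | hcb
  · refine (hg a b hab).congr fun N hN => ?_
    have := mul_le_mul_of_nonneg_left hbc (by omega : 0 ≤ N)
    congr 1
    refine Finset.sum_congr rfl fun X hX => hfg N X hN ?_
    rw [mem_halfInterval] at hX
    omega
  refine (((hg a c hac).add (hh c b hcb)).sub (hh c c le_rfl)).congr fun N hN => ?_
  have h1 := mul_le_mul_of_nonneg_left hac (by omega : 0 ≤ N)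
  have h2 := mul_le_mul_of_nonneg_left hcb (by omega : 0 ≤ N)
  have hunion : halfInterval a b N = halfInterval a c N ∪ halfInterval c b N := by
    ext X
    simp only [Finset.mem_union, mem_halfInterval]
    omega
  have hinter : halfInterval c c N = halfInterval a c N ∩ halfInterval c b N := by
    ext X
    simp only [Finset.mem_inter, mem_halfInterval]
    omega
  have hg' : ∑ X ∈ halfInterval a c N, g N X = ∑ X ∈ halfInterval a c N, f N X :=
    Finset.sum_congr rfl fun X hX => (hfg N X hN (mem_halfInterval.mp hX).2).symm
  have hh' (b : ℤ) : ∑ X ∈ halfInterval c b N, h N X = ∑ X ∈ halfInterval c b N, f N X :=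
    Finset.sum_congr rfl fun X hX => (hfh N X hN (mem_halfInterval.mp hX).1).symm
  rw [hg', hh', hh', hunion, hinter, ← Int.cast_add, ← Finset.sum_union_inter]
  push_cast
  ring

end HasQuasipolySums

/-- The number of integral points of the `N`-th dilate of the polygon
`2X ≥ m`, `Y ≥ 0`, `A ≤ X + Y ≤ B`, `C ≤ X - Y ≤ D`. -/
theorem isQuadraticQuasipoly_ncard (m A B C D : ℤ) :
    IsQuadraticQuasipoly (fun N => (Set.ncard {p : ℤ × ℤ | N * m ≤ 2 * p.1 ∧ 0 ≤ p.2 ∧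
      N * A ≤ p.1 + p.2 ∧ p.1 + p.2 ≤ N * B ∧ N * C ≤ p.1 - p.2 ∧ p.1 - p.2 ≤ N * D} : ℚ)) := by
  let a := max m (max (2 * C) (A + C))
  let b := min (2 * B) (B + D)
  let L (N X : ℤ) : ℤ := max (max 0 (N * A - X)) (X - N * D)
  let U (N X : ℤ) : ℤ := min (X - N * C) (N * B - X)
  have ha (N : ℤ) (hN : 1 ≤ N) :
      N * a = max (N * m) (max (2 * (N * C)) (N * A + N * C)) := by
    simp only [a, mul_max_of_nonneg _ _ (by omega : 0 ≤ N)]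
    ring_nf
  have hb (N : ℤ) (hN : 1 ≤ N) : N * b = min (2 * (N * B)) (N * B + N * D) := by
    simp only [b, mul_min_of_nonneg _ _ (by omega : 0 ≤ N)]
    ring_nf
  by_cases hne : A ≤ B ∧ C ≤ D ∧ a ≤ b
  · obtain ⟨hAB, hCD, hab⟩ := hne
    have hU : HasQuasipolySums U := by
      refine (HasQuasipolySums.affine 1 (-C) 0).piecewise
        (HasQuasipolySums.affine (-1) B 0) (B + C) ?_ ?_ <;>
      · intro N X _ hX
        rw [mul_add] at hX
        simp only [U, neg_mul, mul_comm C N, mul_comm B N]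
        omega
    have hL₀ : HasQuasipolySums (fun N X => max 0 (N * A - X)) := by
      refine (HasQuasipolySums.affine (-1) A 0).piecewise
        (HasQuasipolySums.affine 0 0 0) (2 * A) ?_ ?_ <;>
      · intro N X _ hX
        rw [mul_left_comm] at hX
        have := mul_comm A N
        omega
    have hL : HasQuasipolySums L := by
      refine hL₀.piecewise (HasQuasipolySums.affine 1 (-D) 0) (max (2 * D) (A + D)) ?_ ?_ <;>
      · intro N X hN hX
        rw [mul_max_of_nonneg _ _ (by omega : 0 ≤ N), mul_left_comm, mul_add] at hX
        simp only [L, neg_mul, mul_comm D N]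
        omega
    refine (((hU.add (HasQuasipolySums.affine 0 0 1)).sub hL) a b hab).congr fun N hN => ?_
    have hAB' := mul_le_mul_of_nonneg_left hAB (by omega : 0 ≤ N)
    have hCD' := mul_le_mul_of_nonneg_left hCD (by omega : 0 ≤ N)
    have hset : {p : ℤ × ℤ | N * m ≤ 2 * p.1 ∧ 0 ≤ p.2 ∧ N * A ≤ p.1 + p.2 ∧
        p.1 + p.2 ≤ N * B ∧ N * C ≤ p.1 - p.2 ∧ p.1 - p.2 ≤ N * D} =
        (((halfInterval a b N).sigma fun X => Finset.Icc (L N X) (U N X)).map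
          (Equiv.sigmaEquivProd ℤ ℤ).toEmbedding : Finset (ℤ × ℤ)) := by
      ext ⟨X, Y⟩
      simp only [Set.mem_ofPred_eq, Finset.coe_map, Set.mem_image, Finset.mem_coe,
        Finset.mem_sigma, mem_halfInterval, Finset.mem_Icc, ha N hN, hb N hN, L, U,
        Equiv.coe_toEmbedding, Equiv.sigmaEquivProd_apply, Sigma.exists, Prod.mk.injEq]
      constructor
      · intro h
        exact ⟨X, Y, by omega, rfl, rfl⟩
      · rintro ⟨X, Y, h, rfl, rfl⟩
        omega
    rw [hset, Set.ncard_coe_finset, Finset.card_map, Finset.card_sigma, ← Int.cast_natCast]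
    congr 1
    rw [Nat.cast_sum]
    refine Finset.sum_congr rfl fun X hX => ?_
    rw [mem_halfInterval, ha N hN, hb N hN] at hX
    simp only [Int.card_Icc, L, U]
    omega
  · refine ⟨0, 0, 0, fun N hN => ?_⟩
    have hempty : {p : ℤ × ℤ | N * m ≤ 2 * p.1 ∧ 0 ≤ p.2 ∧ N * A ≤ p.1 + p.2 ∧
        p.1 + p.2 ≤ N * B ∧ N * C ≤ p.1 - p.2 ∧ p.1 - p.2 ≤ N * D} = ∅ := by
      refine Set.eq_empty_of_forall_notMem ?_
      rintro ⟨X, Y⟩ ⟨h1, h2, h3, h4, h5, h6⟩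
      dsimp only at h1 h2 h3 h4 h5 h6
      refine hne ⟨?_, ?_, ?_⟩ <;> refine le_of_mul_le_mul_left ?_ (by omega : 0 < N)
      · omega
      · omega
      · rw [ha N hN, hb N hN]
        omega
    simp only [hempty, Set.ncard_empty, Nat.cast_zero, Pi.zero_apply, zero_mul, add_zero]

theorem stmt_7 (r s γ1 γ2 : ℤ) :
    ∃ p₀ p₁ : Polynomial ℚ, p₀.degree ≤ 2 ∧ p₁.degree ≤ 2 ∧
      ∀ N : ℤ, 1 ≤ N →
        (Even N → (R (N * r) (N * s) (N * γ1) (N * γ2) : ℚ) = p₀.eval (N : ℚ)) ∧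
        (Odd N → (R (N * r) (N * s) (N * γ1) (N * γ2) : ℚ) = p₁.eval (N : ℚ)) := by
  apply IsQuadraticQuasipoly.exists_polynomial
    (F := fun N => (R (N * r) (N * s) (N * γ1) (N * γ2) : ℚ))
  refine (isQuadraticQuasipoly_ncard (2 * max r s) (r + s - γ1) (r + s - γ2) γ1
    (γ1 + γ2)).congr fun N hN => ?_
  rw [R]
  congr 2
  ext ⟨X, Y⟩
  have hm : N * (2 * max r s) = 2 * max (N * r) (N * s) := by
    rw [← mul_max_of_nonneg _ _ (by omega : 0 ≤ N)]
    ring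
  simp only [Set.mem_ofPred_eq, hm, mul_add, mul_sub]
  omega
end

section
/- Let n, r, s, γ1, γ2 be integers with r ≥ 0, s ≥ 0, 2r ≤ n, 2s ≤ n, 0 ≤ γ2 ≤ γ1, and 2γ1 + γ2 ≤ n. Then G(n, r, s, γ1, γ2) ≥ 0. (The alternating sum of three reduced Kronecker coefficients expressing a Kronecker coefficient indexed by two two-row shapes is nonnegative.) -/
/-- `G n r s γ1 γ2` is the alternating sum of reduced Kronecker coefficients
recovering the Kronecker coefficient `g_{(n−r,r),(n−s,s)}^{(n−γ1−γ2,γ1,γ2)}`. -/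
noncomputable def G (n r s γ1 γ2 : ℤ) : ℤ :=
  (R r s γ1 γ2 : ℤ) - (R r s (n - γ1 - γ2 + 1) γ2 : ℤ)
    + (R r s (n - γ1 - γ2 + 1) (γ1 + 1) : ℤ)

/-- The region of integral points counted by `R`. -/
def regionR (r s γ1 γ2 : ℤ) : Set (ℤ × ℤ) :=
  {p : ℤ × ℤ |
    s ≤ p.1 ∧ r ≤ p.1 ∧ r + s - γ1 ≤ p.1 + p.2 ∧ 0 ≤ p.2 ∧
    0 ≤ p.2 - p.1 + γ1 + γ2 ∧ p.1 + p.2 ≤ r + s - γ2 ∧ γ1 ≤ p.1 - p.2}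

theorem regionR_finite (r s γ1 γ2 : ℤ) : (regionR r s γ1 γ2).Finite := by
  refine (Set.finite_Icc ((r, 0) : ℤ × ℤ) (r + s - γ2, r + s - γ2 - r)).subset ?_
  rintro ⟨x, y⟩ h
  simp only [regionR, Set.mem_ofPred_eq] at h
  simp only [Set.mem_Icc, Prod.mk_le_mk]
  omega

theorem R_comm (r s γ1 γ2 : ℤ) : R r s γ1 γ2 = R s r γ1 γ2 := by
  unfold R
  congr 1
  ext p
  simp only [Set.mem_ofPred_eq]
  omega

/-- The points of `regionR r s (n - γ1 - γ2 + 1) γ2` that do not cancel against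
`regionR r s (n - γ1 - γ2 + 1) (γ1 + 1)`. -/
def excessRegion (n r s γ1 γ2 : ℤ) : Set (ℤ × ℤ) :=
  {p ∈ regionR r s (n - γ1 - γ2 + 1) γ2 | r + s - γ1 ≤ p.1 + p.2}

/-- In the coordinates `a = X - Y`, `c = r + s - X - Y`, a row `c = const` of the excess region
is either reflected by `a ↦ 2r - a`, or translated by `a ↦ a - (n - 2γ1 - γ2 + 1)`, which is
possible when this translation preserves parity. -/
theorem ncard_excessRegion_le_of_even {n r s γ1 γ2 t : ℤ} (hsr : s ≤ r) (hrn : 2 * r ≤ n)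
    (hγn : 2 * γ1 + γ2 ≤ n) (ht : n - 2 * γ1 - γ2 + 1 = 2 * t) :
    (excessRegion n r s γ1 γ2).ncard ≤ R r s γ1 γ2 := by
  refine Set.ncard_le_ncard_of_injOn
    (fun p => if 2 * r ≤ p.1 + p.2 + γ1 then (p.1 - t, p.2 + t) else (r + p.2, p.1 - r))
    ?_ ?_ (regionR_finite r s γ1 γ2)
  · rintro ⟨x, y⟩ h
    simp only [excessRegion, regionR, Set.mem_ofPred_eq] at h ⊢
    split_ifs <;> dsimp only <;> omega
  · rintro ⟨x, y⟩ h ⟨x', y'⟩ h' heq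
    simp only [excessRegion, regionR, Set.mem_ofPred_eq] at h h'
    dsimp only at heq
    split_ifs at heq <;> simp only [Prod.mk.injEq] at heq ⊢ <;> omega

/-- When translation by `n - 2γ1 - γ2 + 1` changes parity, it is rounded to a neighbouring even
translation; the only point that then leaves the target row, `a = n - γ1 + 1`, is sent to the
end of the next row. -/
theorem ncard_excessRegion_le_of_odd {n r s γ1 γ2 m : ℤ} (hsr : s ≤ r) (hrn : 2 * r ≤ n)
    (hγ2 : 0 ≤ γ2) (hγn : 2 * γ1 + γ2 ≤ n) (hm : n - 2 * γ1 - γ2 + 1 = 2 * m + 1) :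
    (excessRegion n r s γ1 γ2).ncard ≤ R r s γ1 γ2 := by
  refine Set.ncard_le_ncard_of_injOn
    (fun p =>
      if 2 * r ≤ p.1 + p.2 + γ1 then
        if (p.1 - p.2 - (n - γ1 - γ2 + 1)) % 2 = 0 then
          if p.1 - p.2 = n - γ1 + 1 then (p.1 - m - 1, p.2 + m) else (p.1 - m, p.2 + m)
        else (p.1 - m - 1, p.2 + m + 1)
      else (r + p.2, p.1 - r))
    ?_ ?_ (regionR_finite r s γ1 γ2)
  · rintro ⟨x, y⟩ h
    simp only [excessRegion, regionR, Set.mem_ofPred_eq] at h ⊢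
    split_ifs <;> dsimp only <;> omega
  · rintro ⟨x, y⟩ h ⟨x', y'⟩ h' heq
    simp only [excessRegion, regionR, Set.mem_ofPred_eq] at h h'
    dsimp only at heq
    split_ifs at heq <;> simp only [Prod.mk.injEq] at heq ⊢ <;> omega

theorem ncard_excessRegion_le {n r s γ1 γ2 : ℤ} (hsr : s ≤ r) (hrn : 2 * r ≤ n)
    (hγ2 : 0 ≤ γ2) (hγn : 2 * γ1 + γ2 ≤ n) :
    (excessRegion n r s γ1 γ2).ncard ≤ R r s γ1 γ2 := by
  obtain ⟨t, ht | ht⟩ := Int.even_or_odd' (n - 2 * γ1 - γ2 + 1)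
  · exact ncard_excessRegion_le_of_even hsr hrn hγn ht
  · exact ncard_excessRegion_le_of_odd hsr hrn hγ2 hγn ht

theorem R_le_ncard_excessRegion_add {n r s γ1 γ2 : ℤ} (hγ : γ2 ≤ γ1) :
    R r s (n - γ1 - γ2 + 1) γ2 ≤
      (excessRegion n r s γ1 γ2).ncard + R r s (n - γ1 - γ2 + 1) (γ1 + 1) := by
  have hfin : (excessRegion n r s γ1 γ2 ∪ regionR r s (n - γ1 - γ2 + 1) (γ1 + 1)).Finite :=
    ((regionR_finite _ _ _ _).subset (Set.sep_subset _ _)).union (regionR_finite _ _ _ _)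
  refine (Set.ncard_le_ncard ?_ hfin).trans (Set.ncard_union_le _ _)
  rintro ⟨x, y⟩ h
  simp only [excessRegion, regionR, Set.mem_union, Set.mem_ofPred_eq] at h ⊢
  omega

theorem G_nonneg_of_le {n r s γ1 γ2 : ℤ} (hsr : s ≤ r) (hrn : 2 * r ≤ n)
    (hγ2 : 0 ≤ γ2) (hγ : γ2 ≤ γ1) (hγn : 2 * γ1 + γ2 ≤ n) :
    0 ≤ G n r s γ1 γ2 := by
  have hle := ncard_excessRegion_le hsr hrn hγ2 hγn
  have hadd := R_le_ncard_excessRegion_add (n := n) (r := r) (s := s) hγ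
  unfold G
  omega

theorem stmt_10 (n r s γ1 γ2 : ℤ)
    (hr : 0 ≤ r) (hs : 0 ≤ s) (hrn : 2 * r ≤ n) (hsn : 2 * s ≤ n)
    (hγ2 : 0 ≤ γ2) (hγ : γ2 ≤ γ1) (hγn : 2 * γ1 + γ2 ≤ n) :
    0 ≤ G n r s γ1 γ2 := by
  rcases le_total s r with h | h
  · exact G_nonneg_of_le h hrn hγ2 hγ hγn
  · have hG := G_nonneg_of_le h hsn hγ2 hγ hγn
    unfold G at hG ⊢
    rwa [R_comm r s, R_comm r s, R_comm r s]
end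

section
/- Let n, r, s, γ1, γ2 be integers with γ2 ≤ γ1 and n ≥ r + s + γ1. Then G(n, r, s, γ1, γ2) = R(r, s, γ1, γ2); that is, the two correction terms vanish and the Kronecker coefficient g_{(n−r,r),(n−s,s)}^{(n−γ1−γ2,γ1,γ2)} equals its stable (reduced) value ḡ_{(r)(s)}^{(γ1,γ2)} as soon as n ≥ r + s + γ1. (This makes Murnaghan's stability explicit for Kronecker coefficients indexed by two two-row shapes.) -/
/-- The inequalities defining `R` force `γ1 ≤ X - Y ≤ X + Y ≤ r + s - γ2`. -/
theorem R_eq_zero_of_lt {r s γ1 γ2 : ℤ} (h : r + s < γ1 + γ2) : R r s γ1 γ2 = 0 := by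
  refine (congrArg Set.ncard (Set.eq_empty_of_forall_notMem ?_)).trans (Set.ncard_empty _)
  rintro ⟨X, Y⟩ ⟨-, -, -, hY, -, hadd, hsub⟩
  dsimp only at hY hadd hsub
  omega

theorem stmt_11 (n r s γ1 γ2 : ℤ) (hγ : γ2 ≤ γ1) (hn : r + s + γ1 ≤ n) :
    G n r s γ1 γ2 = (R r s γ1 γ2 : ℤ) := by
  have h₁ : R r s (n - γ1 - γ2 + 1) γ2 = 0 := R_eq_zero_of_lt (by omega)
  have h₂ : R r s (n - γ1 - γ2 + 1) (γ1 + 1) = 0 := R_eq_zero_of_lt (by omega)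
  simp [G, h₁, h₂]
end

section
/- Let n, r, s, γ1, γ2 be integers with r ≥ 0, s ≥ 0, 2r ≤ n, 2s ≤ n, 0 ≤ γ2 ≤ γ1, and 2γ1 + γ2 ≤ n. Then there exist polynomials p₀, p₁ with rational coefficients, each of degree at most 2, such that for every integer N ≥ 1 one has G(Nn, Nr, Ns, Nγ1, Nγ2) = p₀(N) if N is even and G(Nn, Nr, Ns, Nγ1, Nγ2) = p₁(N) if N is odd. (The stretching function of a Kronecker coefficient indexed by two two-row shapes is a quadratic quasipolynomial of period dividing 2.) -/
open Finset

/-- The lattice points of the first quadrant with `x + y ≤ c` and `x - y ≤ d`. -/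
noncomputable def cutTriangle (c d : ℤ) : Finset (ℤ × ℤ) :=
  (Icc 0 c ×ˢ Icc 0 c).filter fun p => p.1 + p.2 ≤ c ∧ p.1 - p.2 ≤ d

theorem mem_cutTriangle {c d : ℤ} {p : ℤ × ℤ} :
    p ∈ cutTriangle c d ↔ 0 ≤ p.1 ∧ 0 ≤ p.2 ∧ p.1 + p.2 ≤ c ∧ p.1 - p.2 ≤ d := by
  simp only [cutTriangle, mem_filter, mem_product, mem_Icc]
  omega

/-- The number of points of `cutTriangle c d`, as an integer. -/
noncomputable def cutCount (c d : ℤ) : ℤ := (cutTriangle c d).card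

theorem cutCount_eq_zero {c d : ℤ} (h : c ≤ -1 ∨ c + d ≤ -1) : cutCount c d = 0 := by
  simp only [cutCount, Nat.cast_eq_zero, card_eq_zero, eq_empty_iff_forall_notMem,
    mem_cutTriangle]
  intro p
  omega

/-- Splitting off the points with `x + y = c + 1`. -/
theorem cutCount_add_one (c d : ℤ) :
    cutCount (c + 1) d = cutCount c d + max 0 (min (c + 1) ((c + 1 + d) / 2) + 1) := by
  have key : cutTriangle (c + 1) d = cutTriangle c d ∪
      (Icc 0 (min (c + 1) ((c + 1 + d) / 2))).image fun x => (x, c + 1 - x) := by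
    ext ⟨x, y⟩
    simp only [mem_union, mem_cutTriangle, mem_image, mem_Icc, Prod.mk.injEq]
    constructor
    · intro h
      by_cases hc : x + y ≤ c
      · left; omega
      · right; exact ⟨x, by omega, rfl, by omega⟩
    · rintro (h | ⟨z, h, rfl, rfl⟩) <;> omega
  have disj : Disjoint (cutTriangle c d)
      ((Icc 0 (min (c + 1) ((c + 1 + d) / 2))).image fun x => (x, c + 1 - x)) := by
    rw [disjoint_left]
    simp only [mem_cutTriangle, mem_image, not_exists, not_and]
    rintro p hp x - rfl
    simp at hp
  have inj : Function.Injective fun x : ℤ => (x, c + 1 - x) := fun x y h => by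
    simpa using congrArg Prod.fst h
  rw [cutCount, key, card_union_of_disjoint disj, card_image_of_injective _ inj, Int.card_Icc]
  simp only [cutCount]
  omega

theorem cutCount_of_le {c d : ℤ} (hc : -2 ≤ c) (hcd : c ≤ d) :
    4 * cutCount c d = 2 * ((c + 1) * (c + 2)) := by
  induction c, hc using Int.leInduction with
  | base => rw [cutCount_eq_zero (by omega)]; norm_num
  | succ c hc ih =>
    have hmax : max 0 (min (c + 1) ((c + 1 + d) / 2) + 1) = c + 2 := by omega
    rw [cutCount_add_one, hmax]
    linear_combination ih (by omega)

theorem sq_sub_emod_two_add_one (k : ℤ) :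
    (k + 1) ^ 2 - (k + 1) % 2 = k ^ 2 - k % 2 + 4 * ((k + 1) / 2) := by
  have h : 2 * k + 1 - (k + 1) % 2 = - (k % 2) + 4 * ((k + 1) / 2) := by omega
  linear_combination h

theorem cutCount_of_ge {c d : ℤ} (hd : -1 ≤ d) (hc : -2 ≤ c) (hcd : d - 2 ≤ c) :
    4 * cutCount c d =
      2 * ((c + 1) * (c + 2)) - ((c - d + 1) ^ 2 - (c - d + 1) % 2) := by
  rcases le_total c d with h | h
  · rw [cutCount_of_le hc h]
    obtain h | h | h : c - d + 1 = -1 ∨ c - d + 1 = 0 ∨ c - d + 1 = 1 := by omega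
    all_goals rw [h]; norm_num
  · clear hc hcd
    induction c, h using Int.leInduction with
    | base => rw [cutCount_of_le (by omega) le_rfl]; norm_num
    | succ c hc ih =>
      have hmax : max 0 (min (c + 1) ((c + 1 + d) / 2) + 1) = c + 2 - (c - d + 1 + 1) / 2 := by
        omega
      have hk : c + 1 - d + 1 = c - d + 1 + 1 := by ring
      rw [cutCount_add_one, hmax, hk]
      linear_combination ih + sq_sub_emod_two_add_one (c - d + 1)

theorem cutCount_of_nonpos {c d : ℤ} (hd : d ≤ 0) (hcd : -3 - d ≤ c) :
    4 * cutCount c d = (c + d + 2) ^ 2 - (c + d + 2) % 2 := by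
  induction c, hcd using Int.leInduction with
  | base =>
    have h : -3 - d + d + 2 = -1 := by ring
    rw [cutCount_eq_zero (by omega), h]
    norm_num
  | succ c hc ih =>
    have hmax : max 0 (min (c + 1) ((c + 1 + d) / 2) + 1) = (c + d + 2 + 1) / 2 := by omega
    have hk : c + 1 + d + 2 = c + d + 2 + 1 := by ring
    rw [cutCount_add_one, hmax, hk]
    linear_combination ih - sq_sub_emod_two_add_one (c + d + 2)

theorem R_eq_cutCount {r s γ1 γ2 m k : ℤ} (hr : r ≤ m) (hs : s ≤ m) (hm : m = r ∨ m = s)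
    (hmk : m + k = r + s) (hγ2 : -1 ≤ γ2) (hγ : γ2 ≤ γ1 + 1) :
    (R r s γ1 γ2 : ℤ) = cutCount (k - γ2) (γ1 + γ2 - m) - cutCount (k - γ1 - 1) (γ1 + γ2 - m)
      - cutCount (k - γ2) (γ1 - 1 - m) + cutCount (k - γ1 - 1) (γ1 - 1 - m) := by
  have inj : Function.Injective fun p : ℤ × ℤ => (p.1 + m, p.2) := by
    rintro ⟨x, y⟩ ⟨x', y'⟩ h
    simpa using h
  have hsub : ∀ {c c' d d' : ℤ}, c ≤ c' → d ≤ d' → cutTriangle c d ⊆ cutTriangle c' d' := by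
    intro c c' d d' h h' p
    simp only [mem_cutTriangle]
    omega
  have hset : {p : ℤ × ℤ | s ≤ p.1 ∧ r ≤ p.1 ∧ r + s - γ1 ≤ p.1 + p.2 ∧ 0 ≤ p.2 ∧
      0 ≤ p.2 - p.1 + γ1 + γ2 ∧ p.1 + p.2 ≤ r + s - γ2 ∧ γ1 ≤ p.1 - p.2} =
      (((cutTriangle (k - γ2) (γ1 + γ2 - m) \ cutTriangle (k - γ1 - 1) (γ1 + γ2 - m)) \
        (cutTriangle (k - γ2) (γ1 - 1 - m) \ cutTriangle (k - γ1 - 1) (γ1 - 1 - m))).image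
          fun p : ℤ × ℤ => (p.1 + m, p.2) : Finset (ℤ × ℤ)) := by
    ext ⟨x, y⟩
    simp only [Set.mem_ofPred_eq, mem_coe, mem_image, mem_sdiff, mem_cutTriangle, Prod.mk.injEq,
      Prod.exists]
    constructor
    · intro h
      exact ⟨x - m, y, by omega, by omega, rfl⟩
    · rintro ⟨x', y', h, rfl, rfl⟩
      omega
  have hsub' : cutTriangle (k - γ2) (γ1 - 1 - m) \ cutTriangle (k - γ1 - 1) (γ1 - 1 - m) ⊆
      cutTriangle (k - γ2) (γ1 + γ2 - m) \ cutTriangle (k - γ1 - 1) (γ1 + γ2 - m) := by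
    intro p
    simp only [mem_sdiff, mem_cutTriangle]
    omega
  rw [R, hset, Set.ncard_coe_finset, card_image_of_injective _ inj, cast_card_sdiff hsub',
    cast_card_sdiff (hsub (by omega) le_rfl), cast_card_sdiff (hsub (by omega) le_rfl)]
  simp only [cutCount]
  ring

/-- On the positive integers, `g` is given by a polynomial of degree at most `2` on each parity
class. -/
def IsQuadraticQuasipolynomial (g : ℤ → ℚ) : Prop :=
  ∃ p₀ p₁ : Polynomial ℚ, p₀.degree ≤ 2 ∧ p₁.degree ≤ 2 ∧
    ∀ N : ℤ, 1 ≤ N → (Even N → g N = p₀.eval (N : ℚ)) ∧ (Odd N → g N = p₁.eval (N : ℚ))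

namespace IsQuadraticQuasipolynomial

theorem congr {g h : ℤ → ℚ} (hg : IsQuadraticQuasipolynomial g)
    (hgh : ∀ N, 1 ≤ N → h N = g N) : IsQuadraticQuasipolynomial h := by
  obtain ⟨p₀, p₁, d₀, d₁, hp⟩ := hg
  exact ⟨p₀, p₁, d₀, d₁, fun N hN => by rw [hgh N hN]; exact hp N hN⟩

theorem add {g h : ℤ → ℚ} (hg : IsQuadraticQuasipolynomial g)
    (hh : IsQuadraticQuasipolynomial h) : IsQuadraticQuasipolynomial fun N => g N + h N := by
  obtain ⟨p₀, p₁, d₀, d₁, hp⟩ := hg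
  obtain ⟨q₀, q₁, e₀, e₁, hq⟩ := hh
  refine ⟨p₀ + q₀, p₁ + q₁, Polynomial.degree_add_le_of_degree_le d₀ e₀,
    Polynomial.degree_add_le_of_degree_le d₁ e₁, fun N hN => ⟨fun h => ?_, fun h => ?_⟩⟩
  · simp only [Polynomial.eval_add, (hp N hN).1 h, (hq N hN).1 h]
  · simp only [Polynomial.eval_add, (hp N hN).2 h, (hq N hN).2 h]

theorem sub {g h : ℤ → ℚ} (hg : IsQuadraticQuasipolynomial g)
    (hh : IsQuadraticQuasipolynomial h) : IsQuadraticQuasipolynomial fun N => g N - h N := by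
  obtain ⟨p₀, p₁, d₀, d₁, hp⟩ := hg
  obtain ⟨q₀, q₁, e₀, e₁, hq⟩ := hh
  refine ⟨p₀ - q₀, p₁ - q₁, Polynomial.degree_sub_le_of_le d₀ e₀ |>.trans (by simp),
    Polynomial.degree_sub_le_of_le d₁ e₁ |>.trans (by simp),
    fun N hN => ⟨fun h => ?_, fun h => ?_⟩⟩
  · simp only [Polynomial.eval_sub, (hp N hN).1 h, (hq N hN).1 h]
  · simp only [Polynomial.eval_sub, (hp N hN).2 h, (hq N hN).2 h]

theorem of_coeffs {g : ℤ → ℚ} (u v w w' : ℚ)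
    (h₀ : ∀ N : ℤ, 1 ≤ N → Even N → g N = u * N ^ 2 + v * N + w)
    (h₁ : ∀ N : ℤ, 1 ≤ N → Odd N → g N = u * N ^ 2 + v * N + w') :
    IsQuadraticQuasipolynomial g := by
  refine ⟨.C u * .X ^ 2 + .C v * .X + .C w, .C u * .X ^ 2 + .C v * .X + .C w',
    Polynomial.degree_quadratic_le, Polynomial.degree_quadratic_le,
    fun N hN => ⟨fun h => ?_, fun h => ?_⟩⟩
  · simp [h₀ N hN h]
  · simp [h₁ N hN h]

theorem zero : IsQuadraticQuasipolynomial fun _ => 0 :=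
  of_coeffs 0 0 0 0 (by simp) (by simp)

theorem triangle (a b : ℤ) : IsQuadraticQuasipolynomial fun N =>
    (((N * a + b + 1) * (N * a + b + 2) : ℤ) : ℚ) / 2 :=
  of_coeffs (a ^ 2 / 2) (a * (2 * b + 3) / 2) ((b + 1) * (b + 2) / 2) ((b + 1) * (b + 2) / 2)
    (fun N _ _ => by push_cast; ring) (fun N _ _ => by push_cast; ring)

theorem quarterSquare (a b : ℤ) : IsQuadraticQuasipolynomial fun N =>
    (((N * a + b) ^ 2 - (N * a + b) % 2 : ℤ) : ℚ) / 4 := by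
  refine of_coeffs (a ^ 2 / 4) (a * b / 2) ((b ^ 2 - (b % 2 : ℤ)) / 4)
    ((b ^ 2 - ((a + b) % 2 : ℤ)) / 4) (fun N _ hN => ?_) (fun N _ hN => ?_)
  · obtain ⟨j, rfl⟩ := hN
    have h : ((j + j) * a + b) % 2 = b % 2 := by
      rw [show (j + j) * a + b = b + 2 * (j * a) by ring, Int.add_mul_emod_self_left]
    rw [h]
    push_cast
    ring
  · obtain ⟨j, rfl⟩ := hN
    have h : ((2 * j + 1) * a + b) % 2 = (a + b) % 2 := by
      rw [show (2 * j + 1) * a + b = a + b + 2 * (j * a) by ring, Int.add_mul_emod_self_left]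
    rw [h]
    push_cast
    ring

/-- The bounds on the offsets `b`, `f` ensure that the formula for `cutCount` does not change along
the ray, even at its first points. -/
theorem cutCount {a b e f : ℤ} (hb : -2 ≤ b) (hb' : b ≤ 0) (hf : -1 ≤ f)
    (hneg : 0 ≤ a → e < 0 → f ≤ 1 ∧ b + f ≤ 0)
    (hpos : 0 ≤ a → e < a → -3 ≤ b - f) :
    IsQuadraticQuasipolynomial fun N => (cutCount (N * a + b) (N * e + f) : ℚ) := by
  have hle : ∀ {N x : ℤ}, 1 ≤ N → x ≤ -1 → N * x ≤ -1 := fun hN hx => by nlinarith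
  have hge : ∀ {N x : ℤ}, 1 ≤ N → 1 ≤ x → 1 ≤ N * x := fun hN hx => by nlinarith
  have hsub : ∀ N : ℤ, N * (a - e) = N * a - N * e := fun N => mul_sub ..
  have hadd : ∀ N : ℤ, N * (a + e) = N * a + N * e := fun N => mul_add ..
  by_cases hc : a < 0 ∨ a = 0 ∧ b < 0
  · refine zero.congr fun N hN => ?_
    rw [cutCount_eq_zero, Int.cast_zero]
    left
    rcases hc with h | ⟨rfl, h⟩
    · linarith [hle hN (show a ≤ -1 by omega)]
    · linarith [mul_zero N]
  have hc' : ∀ N : ℤ, 1 ≤ N → -1 ≤ N * a + b := fun N hN => by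
    rcases lt_trichotomy a 0 with h | rfl | h
    · omega
    · linarith [mul_zero N, show 0 ≤ b by omega]
    · linarith [hge hN h]
  by_cases he : 0 ≤ e
  · have hd : ∀ N : ℤ, 1 ≤ N → -1 ≤ N * e + f := fun N hN => by
      linarith [mul_nonneg (show 0 ≤ N by omega) he]
    by_cases hbig : a < e ∨ a = e ∧ b ≤ f
    · refine (triangle a b).congr fun N hN => ?_
      have h := cutCount_of_le (c := N * a + b) (d := N * e + f) (by linarith [hc' N hN]) (by
        rcases hbig with h | ⟨rfl, h⟩
        · linarith [hle hN (show a - e ≤ -1 by omega), hsub N]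
        · linarith)
      have h' := congrArg (Int.cast : ℤ → ℚ) h
      push_cast at h' ⊢
      linarith
    · refine ((triangle a b).sub (quarterSquare (a - e) (b - f + 1))).congr fun N hN => ?_
      have h := cutCount_of_ge (c := N * a + b) (d := N * e + f) (hd N hN)
        (by linarith [hc' N hN]) (by
          rcases (show e < a ∨ a = e ∧ f < b by omega) with h | ⟨rfl, h⟩
          · linarith [hge hN (show 1 ≤ a - e by omega), hsub N, hpos (by omega) h]
          · linarith)
      rw [show N * a + b - (N * e + f) + 1 = N * (a - e) + (b - f + 1) by ring] at h
      have h' := congrArg (Int.cast : ℤ → ℚ) h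
      push_cast at h' ⊢
      linarith
  · obtain ⟨hf1, hbf⟩ := hneg (by omega) (by omega)
    have hd : ∀ N : ℤ, 1 ≤ N → N * e + f ≤ 0 := fun N hN => by
      linarith [hle hN (show e ≤ -1 by omega)]
    by_cases hsmall : a + e < 0
    · refine zero.congr fun N hN => ?_
      rw [cutCount_eq_zero, Int.cast_zero]
      right
      linarith [hle hN (show a + e ≤ -1 by omega), hadd N]
    · refine (quarterSquare (a + e) (b + f + 2)).congr fun N hN => ?_
      have h := cutCount_of_nonpos (c := N * a + b) (d := N * e + f) (hd N hN) (by
        linarith [mul_nonneg (show 0 ≤ N by omega) (show 0 ≤ a + e by omega), hadd N])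
      rw [show N * a + b + (N * e + f) + 2 = N * (a + e) + (b + f + 2) by ring] at h
      have h' := congrArg (Int.cast : ℤ → ℚ) h
      push_cast at h' ⊢
      linarith

end IsQuadraticQuasipolynomial

theorem G_eq_cutCount {n r s γ0 γ1 γ2 m k : ℤ} (hr : r ≤ m) (hs : s ≤ m) (hm : m = r ∨ m = s)
    (hmk : m + k = r + s) (hn : n = γ0 + γ1 + γ2) (hγ2 : 0 ≤ γ2) (hγ : γ2 ≤ γ1)
    (hγ0 : γ1 ≤ γ0) :
    G n r s γ1 γ2 =
      cutCount (k - γ2) (γ1 + γ2 - m) - cutCount (k - γ1 - 1) (γ1 + γ2 - m)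
      - cutCount (k - γ2) (γ1 - m - 1) + cutCount (k - γ1 - 1) (γ1 - m - 1)
      - cutCount (k - γ2) (γ0 + γ2 - m + 1) + cutCount (k - γ0 - 2) (γ0 + γ2 - m + 1)
      + cutCount (k - γ2) (γ0 - m) + cutCount (k - γ1 - 1) (γ0 + γ1 - m + 2)
      - cutCount (k - γ0 - 2) (γ0 + γ1 - m + 2) - cutCount (k - γ1 - 1) (γ0 - m) := by
  rw [G, show n - γ1 - γ2 + 1 = γ0 + 1 by omega,
    R_eq_cutCount hr hs hm hmk (by omega) (by omega),
    R_eq_cutCount hr hs hm hmk (by omega) (by omega),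
    R_eq_cutCount hr hs hm hmk (by omega) (by omega)]
  ring_nf

theorem stmt_13 (n r s γ1 γ2 : ℤ)
    (hr : 0 ≤ r) (hs : 0 ≤ s) (hrn : 2 * r ≤ n) (hsn : 2 * s ≤ n)
    (hγ2 : 0 ≤ γ2) (hγ : γ2 ≤ γ1) (hγn : 2 * γ1 + γ2 ≤ n) :
    ∃ p₀ p₁ : Polynomial ℚ, p₀.degree ≤ 2 ∧ p₁.degree ≤ 2 ∧
      ∀ N : ℤ, 1 ≤ N →
        (Even N → (G (N * n) (N * r) (N * s) (N * γ1) (N * γ2) : ℚ) = p₀.eval (N : ℚ)) ∧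
        (Odd N → (G (N * n) (N * r) (N * s) (N * γ1) (N * γ2) : ℚ) = p₁.eval (N : ℚ)) := by
  obtain ⟨γ0, hn⟩ : ∃ γ0, n = γ0 + γ1 + γ2 := ⟨n - γ1 - γ2, by ring⟩
  obtain ⟨m, k, hrm, hsm, hm, hmk⟩ :
      ∃ m k, r ≤ m ∧ s ≤ m ∧ (m = r ∨ m = s) ∧ m + k = r + s :=
    ⟨max r s, min r s, by omega, by omega, by omega, by omega⟩
  have term : ∀ a b e f : ℤ, -2 ≤ b ∧ b ≤ 0 ∧ -1 ≤ f ∧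
      (0 ≤ a → e < 0 → f ≤ 1 ∧ b + f ≤ 0) ∧ (0 ≤ a → e < a → -3 ≤ b - f) →
      IsQuadraticQuasipolynomial fun N => (cutCount (N * a + b) (N * e + f) : ℚ) :=
    fun _ _ _ _ h => .cutCount h.1 h.2.1 h.2.2.1 h.2.2.2.1 h.2.2.2.2
  refine (term (k - γ2) 0 (γ1 + γ2 - m) 0 (by omega))
    |>.sub (term (k - γ1) (-1) (γ1 + γ2 - m) 0 (by omega))
    |>.sub (term (k - γ2) 0 (γ1 - m) (-1) (by omega))
    |>.add (term (k - γ1) (-1) (γ1 - m) (-1) (by omega))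
    |>.sub (term (k - γ2) 0 (γ0 + γ2 - m) 1 (by omega))
    |>.add (term (k - γ0) (-2) (γ0 + γ2 - m) 1 (by omega))
    |>.add (term (k - γ2) 0 (γ0 - m) 0 (by omega))
    |>.add (term (k - γ1) (-1) (γ0 + γ1 - m) 2 (by omega))
    |>.sub (term (k - γ0) (-2) (γ0 + γ1 - m) 2 (by omega))
    |>.sub (term (k - γ1) (-1) (γ0 - m) 0 (by omega))
    |>.congr fun N hN => ?_
  have hN0 : 0 ≤ N := by omega
  rw [G_eq_cutCount (mul_le_mul_of_nonneg_left hrm hN0) (mul_le_mul_of_nonneg_left hsm hN0)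
    (hm.imp (congrArg _) (congrArg _)) (k := N * k) (γ0 := N * γ0)
    (by linear_combination N * hmk) (by linear_combination N * hn) (mul_nonneg hN0 hγ2)
    (mul_le_mul_of_nonneg_left hγ hN0) (mul_le_mul_of_nonneg_left (by omega) hN0)]
  push_cast
  simp only [mul_sub, mul_add, add_zero, ← sub_eq_add_neg]
end
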